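/- With K = ℚ, c = 2, and F = F^{OI,1} ⊕ F^{OI,1} ⊕ F^{OI,2}, let b1 = x_{1,1}·e_{id[1],1} + x_{2,1}·e_{id[1],2} ∈ F_1, b2 = x_{1,2}x_{1,1}·e_{π,2} + x_{2,2}x_{2,1}·e_{id[2],3} ∈ F_2 (where π: [1] → [2] is 1 ↦ 2), and b3 = x_{2,3}x_{2,2}x_{1,1}·e_{σ1,3} − x_{2,3}x_{2,1}x_{1,2}·e_{σ2,3} ∈ F_3 (where σ1, σ2: [2] → [3] have images {2,3} and {1,3} respectively). Then for every natural number n ≥ 3 and every strictly increasing map τ: [3] → [n], the element F(τ)(b3) lies in the P_n-submodule of F_n generated by the set {F(ε)(b1) : ε ∈ Hom(1,n)} ∪ {F(δ)(b2) : δ ∈ Hom(2,n)}. -/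

import Mathlib

noncomputable section

open MvPolynomial

/-- `P_n = ℚ[x_{i,j} : 1 ≤ i ≤ 2, 1 ≤ j ≤ n]`, the width-`n` component of the
polynomial OI-algebra `P^2` over `ℚ`. -/
abbrev P (n : ℕ) := MvPolynomial (Fin 2 × Fin n) ℚ

/-- The variable `x_{i+1,j+1}` of `P_n` (zero-indexed). -/
def x {n : ℕ} (i : Fin 2) (j : Fin n) : P n := X (i, j)

/-- Index set for the basis of the width-`n` component of `F = F^{OI,1} ⊕ F^{OI,1} ⊕ F^{OI,2}`. -/
abbrev Idx (n : ℕ) := (Fin 1 ↪o Fin n) ⊕ ((Fin 1 ↪o Fin n) ⊕ (Fin 2 ↪o Fin n))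

/-- The width-`n` component `F_n` of `F = F^{OI,1} ⊕ F^{OI,1} ⊕ F^{OI,2}`. -/
abbrev FF (n : ℕ) := Idx n →₀ P n

/-- Basis element `e_{π,1}` of `F_n`. -/
def e1 {n : ℕ} (π : Fin 1 ↪o Fin n) : FF n := Finsupp.single (Sum.inl π) 1
/-- Basis element `e_{π,2}` of `F_n`. -/
def e2 {n : ℕ} (π : Fin 1 ↪o Fin n) : FF n := Finsupp.single (Sum.inr (Sum.inl π)) 1
/-- Basis element `e_{σ,3}` of `F_n`. -/
def e3 {n : ℕ} (σ : Fin 2 ↪o Fin n) : FF n := Finsupp.single (Sum.inr (Sum.inr σ)) 1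

/-- The structure map `F(ε) : F_m → F_n`, sending `a·e_{π,i}` to `ε_*(a)·e_{ε∘π,i}`. -/
def Fmap {m n : ℕ} (ε : Fin m ↪o Fin n) (v : FF m) : FF n :=
  v.sum fun i a =>
    Finsupp.single
      (Sum.map (fun π => π.trans ε) (Sum.map (fun π => π.trans ε) (fun σ => σ.trans ε)) i)
      (rename (Prod.map id ⇑ε) a)

/-- `id_{[1]} : [1] → [1]`. -/
def id1 : Fin 1 ↪o Fin 1 := Finset.orderEmbOfFin (Finset.univ : Finset (Fin 1)) (by decide)
/-- `π : [1] → [2]`, `1 ↦ 2`. -/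
def π : Fin 1 ↪o Fin 2 := Finset.orderEmbOfFin ({1} : Finset (Fin 2)) (by decide)
/-- `id_{[2]} : [2] → [2]`. -/
def id2 : Fin 2 ↪o Fin 2 := Finset.orderEmbOfFin (Finset.univ : Finset (Fin 2)) (by decide)
/-- `σ1 : [2] → [3]` with image `{2,3}`. -/
def σ1 : Fin 2 ↪o Fin 3 := Finset.orderEmbOfFin ({1, 2} : Finset (Fin 3)) (by decide)
/-- `σ2 : [2] → [3]` with image `{1,3}`. -/
def σ2 : Fin 2 ↪o Fin 3 := Finset.orderEmbOfFin ({0, 2} : Finset (Fin 3)) (by decide)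

/-- `b1 = x_{1,1}·e_{id[1],1} + x_{2,1}·e_{id[1],2} ∈ F_1`. -/
def b1 : FF 1 := (x 0 0 : P 1) • e1 id1 + (x 1 0 : P 1) • e2 id1
/-- `b2 = x_{1,2}x_{1,1}·e_{π,2} + x_{2,2}x_{2,1}·e_{id[2],3} ∈ F_2`. -/
def b2 : FF 2 := (x 0 1 * x 0 0 : P 2) • e2 π + (x 1 1 * x 1 0 : P 2) • e3 id2
/-- `b3 = x_{2,3}x_{2,2}x_{1,1}·e_{σ1,3} − x_{2,3}x_{2,1}x_{1,2}·e_{σ2,3} ∈ F_3`. -/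
def b3 : FF 3 :=
  (x 1 2 * x 1 1 * x 0 0 : P 3) • e3 σ1 - (x 1 2 * x 1 0 * x 0 1 : P 3) • e3 σ2

theorem Fmap_add' {m n : ℕ} (ε : Fin m ↪o Fin n) (v w : FF m) :
    Fmap ε (v + w) = Fmap ε v + Fmap ε w := by
  unfold Fmap
  apply Finsupp.sum_add_index'
  · intro i; simp
  · intro i a b; simp

theorem Fmap_single' {m n : ℕ} (ε : Fin m ↪o Fin n) (i : Idx m) (a : P m) :
    Fmap ε (Finsupp.single i a) = Finsupp.single
      (Sum.map (fun π => π.trans ε) (Sum.map (fun π => π.trans ε) (fun σ => σ.trans ε)) i)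
      (rename (Prod.map id ⇑ε) a) := by
  unfold Fmap
  apply Finsupp.sum_single_index
  simp

theorem π_zero : π 0 = 1 := by
  have h := Finset.orderEmbOfFin_mem ({1} : Finset (Fin 2)) (k := 1) (by decide) 0
  exact Finset.mem_singleton.1 h

theorem id2_eq (i : Fin 2) : id2 i = i := by
  have h := Finset.orderEmbOfFin_unique (s := (Finset.univ : Finset (Fin 2))) (k := 2)
    (by decide) (f := ![0, 1]) (by decide) (by decide)
  have h2 := congrFun h i
  change _ = id2 i at h2
  rw [← h2]
  fin_cases i <;> rfl

theorem σ1_eq (i : Fin 2) : σ1 i = ![1, 2] i :=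
  (congrFun (Finset.orderEmbOfFin_unique (s := ({1, 2} : Finset (Fin 3))) (k := 2)
    (by decide) (f := ![1, 2]) (by decide) (by decide)) i).symm

theorem σ2_eq (i : Fin 2) : σ2 i = ![0, 2] i :=
  (congrFun (Finset.orderEmbOfFin_unique (s := ({0, 2} : Finset (Fin 3))) (k := 2)
    (by decide) (f := ![0, 2]) (by decide) (by decide)) i).symm

theorem Fmap_b2 {n : ℕ} (δ : Fin 2 ↪o Fin n) :
    Fmap δ b2 = Finsupp.single (Sum.inr (Sum.inl (π.trans δ))) (x 0 (δ 1) * x 0 (δ 0))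
      + Finsupp.single (Sum.inr (Sum.inr δ)) (x 1 (δ 1) * x 1 (δ 0)) := by
  have h : id2.trans δ = δ := by
    ext i
    simp [id2_eq]
  simp only [b2, e2, e3, Finsupp.smul_single, smul_eq_mul, mul_one, Fmap_add', Fmap_single']
  simp [x, h]

theorem Fmap_b3 {n : ℕ} (τ : Fin 3 ↪o Fin n) :
    Fmap τ b3 = Finsupp.single (Sum.inr (Sum.inr (σ1.trans τ))) (x 1 (τ 2) * x 1 (τ 1) * x 0 (τ 0))
      + Finsupp.single (Sum.inr (Sum.inr (σ2.trans τ)))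
        (-(x 1 (τ 2) * x 1 (τ 0) * x 0 (τ 1))) := by
  simp only [b3, e3, Finsupp.smul_single, smul_eq_mul, mul_one, sub_eq_add_neg,
    ← Finsupp.single_neg, Fmap_add', Fmap_single']
  simp [x]

/-- for every `n ≥ 3` and every strictly increasing map `τ : [3] → [n]`,
the element `F(τ)(b3)` lies in the `P_n`-submodule of `F_n` generated by all images
`F(ε)(b1)` for `ε ∈ Hom(1,n)` and `F(δ)(b2)` for `δ ∈ Hom(2,n)`. -/
theorem Fmap_b3_mem_span (n : ℕ) (hn : 3 ≤ n) (τ : Fin 3 ↪o Fin n) :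
    Fmap τ b3 ∈ Submodule.span (P n)
      ({v | ∃ ε : Fin 1 ↪o Fin n, v = Fmap ε b1} ∪
        {v | ∃ δ : Fin 2 ↪o Fin n, v = Fmap δ b2}) := by
  have hπ : π.trans (σ1.trans τ) = π.trans (σ2.trans τ) := by
    ext i
    have : i = 0 := Subsingleton.elim _ _
    subst this
    simp [π_zero, σ1_eq, σ2_eq]
  have key : Fmap τ b3 = (x 0 (τ 0) : P n) • Fmap (σ1.trans τ) b2
      - (x 0 (τ 1) : P n) • Fmap (σ2.trans τ) b2 := by
    rw [Fmap_b3, Fmap_b2, Fmap_b2, hπ]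
    simp only [smul_add, Finsupp.smul_single, smul_eq_mul, RelEmbedding.coe_trans,
      Function.comp_apply, σ1_eq, σ2_eq, Matrix.cons_val_zero, Matrix.cons_val_one]
    rw [add_sub_add_comm, ← Finsupp.single_sub, sub_eq_add_neg (Finsupp.single _ _),
      ← Finsupp.single_neg]
    ring_nf
    simp
  rw [key]
  exact Submodule.sub_mem _
    (Submodule.smul_mem _ _ (Submodule.subset_span (Or.inr ⟨_, rfl⟩)))
    (Submodule.smul_mem _ _ (Submodule.subset_span (Or.inr ⟨_, rfl⟩)))

end
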